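/- Let f be a polynomial automorphism of ℂ². Then the limit λ(f) := lim_{n→∞} (deg fⁿ)^{1/n} exists, and if λ(f) > 1 then f is conjugate in the group of polynomial automorphisms of ℂ² to a regular automorphism: there exists a polynomial automorphism φ of ℂ² such that φ⁻¹ ∘ f ∘ φ is regular. -/

import Mathlib

open MvPolynomial Filter

noncomputable section

/-- Polynomials in two variables over ℂ. -/
abbrev Poly2 : Type := MvPolynomial (Fin 2) ℂ

/-- The polynomial map `ℂ² → ℂ²` with components `P, Q`. -/
def evalPair (P Q : Poly2) (z : ℂ × ℂ) : ℂ × ℂ :=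
  (eval ![z.1, z.2] P, eval ![z.1, z.2] Q)

/-- The degree of the pair `(P, Q)`. -/
def degPair (P Q : Poly2) : ℕ := max P.totalDegree Q.totalDegree

/-- Evaluation at `(x,y)` of the degree-`d` homogeneous part of `F`. -/
def evalHom (d : ℕ) (F : Poly2) (x y : ℂ) : ℂ :=
  eval ![x, y] (homogeneousComponent d F)

/-- `(P,Q)` and `(P',Q')` define mutually inverse polynomial maps of `ℂ²`. -/
def IsInverseQuad (P Q P' Q' : Poly2) : Prop :=
  (∀ z, evalPair P' Q' (evalPair P Q z) = z) ∧
  (∀ z, evalPair P Q (evalPair P' Q' z) = z)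

/-- The polynomial automorphism with components `(P,Q)` and inverse `(P',Q')` is regular. -/
def IsRegularQuad (P Q P' Q' : Poly2) : Prop :=
  2 ≤ degPair P Q ∧ 2 ≤ degPair P' Q' ∧
  ∀ x y : ℂ, (x, y) ≠ ((0 : ℂ), (0 : ℂ)) →
    ¬(evalHom (degPair P Q) P x y = 0 ∧ evalHom (degPair P Q) Q x y = 0 ∧
      evalHom (degPair P' Q') P' x y = 0 ∧ evalHom (degPair P' Q') Q' x y = 0)

/-- The (constant) Jacobian determinant of the polynomial map `(P,Q)`. -/
def Jac2 (P Q : Poly2) : ℂ :=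
  eval ![0, 0] (pderiv 0 P * pderiv 1 Q - pderiv 1 P * pderiv 0 Q)

/-- The set of periodic points of the polynomial map `(P,Q)`. -/
def PerSet (P Q : Poly2) : Set (ℂ × ℂ) :=
  {z | ∃ n : ℕ, 1 ≤ n ∧ (evalPair P Q)^[n] z = z}

/-- `log⁺ t = max (log t) 0`. -/
def logPlus (t : ℝ) : ℝ := max (Real.log t) 0

/-- Composition `F(R, S)` of a polynomial with a pair of polynomials. -/
def pcomp (F R S : Poly2) : Poly2 := aeval ![R, S] F

/-- The pair of polynomials representing the `n`-th iterate of the map `(P,Q)`. -/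
def iterPair (P Q : Poly2) : ℕ → Poly2 × Poly2
  | 0 => (X 0, X 1)
  | n + 1 => (pcomp P (iterPair P Q n).1 (iterPair P Q n).2,
      pcomp Q (iterPair P Q n).1 (iterPair P Q n).2)

/-- The degree of the `n`-th iterate of `(P,Q)`. -/
def degIter (P Q : Poly2) (n : ℕ) : ℕ := degPair (iterPair P Q n).1 (iterPair P Q n).2

section HomogeneousComponents

variable {F G P Q R S : Poly2} {n m p q N : ℕ}

lemma homogeneousComponent_mul_of_le (hF : F.totalDegree ≤ n) (hG : G.totalDegree ≤ m) :
    homogeneousComponent (n + m) (F * G) =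
      homogeneousComponent n F * homogeneousComponent m G := by
  ext d
  rw [coeff_homogeneousComponent, coeff_mul, coeff_mul]
  simp only [coeff_homogeneousComponent]
  have coeff_zero : ∀ {H : Poly2} {k : ℕ} (a : Fin 2 →₀ ℕ), H.totalDegree ≤ k → k < a.degree →
      coeff a H = 0 := fun a hH ha =>
    coeff_eq_zero_of_totalDegree_lt (lt_of_le_of_lt hH ha)
  split_ifs with h
  · refine Finset.sum_congr rfl fun x hx => ?_
    rw [Finset.HasAntidiagonal.mem_antidiagonal] at hx
    have hdeg : x.1.degree + x.2.degree = n + m := by rw [← h, ← hx, map_add]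
    by_cases h1 : n < x.1.degree
    · simp [coeff_zero x.1 hF h1]
    by_cases h2 : m < x.2.degree
    · simp [coeff_zero x.2 hG h2]
    rw [if_pos (by lia), if_pos (by lia)]
  · refine (Finset.sum_eq_zero fun x hx => ?_).symm
    rw [Finset.HasAntidiagonal.mem_antidiagonal] at hx
    have hdeg : x.1.degree + x.2.degree = d.degree := by rw [← hx, map_add]
    by_cases h1 : x.1.degree = n
    · rw [if_neg (show ¬ x.2.degree = m by lia), mul_zero]
    · rw [if_neg h1, zero_mul]

lemma homogeneousComponent_pow_of_le (hF : F.totalDegree ≤ n) (k : ℕ) :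
    homogeneousComponent (k * n) (F ^ k) = homogeneousComponent n F ^ k := by
  induction k with
  | zero => simp [homogeneousComponent_zero]
  | succ k ih =>
    have hk : (F ^ k).totalDegree ≤ k * n :=
      (totalDegree_pow F k).trans (Nat.mul_le_mul_left k hF)
    rw [pow_succ, pow_succ, ← ih, add_mul, one_mul, homogeneousComponent_mul_of_le hk hF]

lemma exists_coeff_ne_zero_degree_eq (hF : F ≠ 0) :
    ∃ d, d.degree = F.totalDegree ∧ coeff d F ≠ 0 := by
  obtain ⟨d, hd, h⟩ := Finset.exists_mem_eq_sup F.support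
    (Finset.nonempty_iff_ne_empty.2 (by simpa using hF)) fun s => s.sum fun _ e => e
  exact ⟨d, h.symm, mem_support_iff.1 hd⟩

lemma homogeneousComponent_totalDegree_ne_zero (hF : F ≠ 0) :
    homogeneousComponent F.totalDegree F ≠ 0 := by
  obtain ⟨d, hd, hdeg⟩ := exists_coeff_ne_zero_degree_eq hF
  intro h
  apply hdeg
  have := congrArg (coeff d) h
  rw [coeff_homogeneousComponent, if_pos] at this
  · simpa using this
  · exact hd

lemma le_totalDegree_of_homogeneousComponent_ne_zero (h : homogeneousComponent n F ≠ 0) :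
    n ≤ F.totalDegree := by
  by_contra! hn
  exact h (homogeneousComponent_eq_zero n F hn)

lemma totalDegree_lt_of_homogeneousComponent_eq_zero (hn : 1 ≤ n) (hF : F.totalDegree ≤ n)
    (h : homogeneousComponent n F = 0) : F.totalDegree < n := by
  by_contra! hlt
  have hd : F.totalDegree = n := le_antisymm hF hlt
  have hF0 : F ≠ 0 := by rintro rfl; simp at hd; lia
  exact homogeneousComponent_totalDegree_ne_zero hF0 (hd ▸ h)

lemma pcomp_monomial (d : Fin 2 →₀ ℕ) (c : ℂ) :
    pcomp (monomial d c) R S = C c * (R ^ d 0 * S ^ d 1) := by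
  rw [pcomp, aeval_monomial, Finsupp.prod_fintype _ _ (by simp), Fin.prod_univ_two]
  simp [algebraMap_eq]

lemma pcomp_eq_sum (F R S : Poly2) :
    pcomp F R S = ∑ d ∈ F.support, C (coeff d F) * (R ^ d 0 * S ^ d 1) := by
  conv_lhs => rw [F.as_sum]
  simp only [← pcomp_monomial]
  simp only [pcomp, map_sum]

lemma eval_pcomp (F R S : Poly2) (z : Fin 2 → ℂ) :
    eval z (pcomp F R S) = eval ![eval z R, eval z S] F := by
  rw [pcomp_eq_sum, eval_eq' _ F]
  simp [Fin.prod_univ_two]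

lemma totalDegree_pcomp_le_of_weight (hP : P.totalDegree ≤ p) (hQ : Q.totalDegree ≤ q)
    (hG : ∀ d ∈ G.support, d 0 * p + d 1 * q ≤ N) : (pcomp G P Q).totalDegree ≤ N := by
  rw [pcomp_eq_sum]
  refine totalDegree_finsetSum_le fun d hd => ?_
  refine (totalDegree_mul _ _).trans ?_
  rw [totalDegree_C, zero_add]
  refine (totalDegree_mul _ _).trans ((add_le_add ?_ ?_).trans (hG d hd))
  · exact (totalDegree_pow _ _).trans (Nat.mul_le_mul_left _ hP)
  · exact (totalDegree_pow _ _).trans (Nat.mul_le_mul_left _ hQ)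

lemma add_le_totalDegree_of_mem_support {d : Fin 2 →₀ ℕ} (hd : d ∈ F.support) :
    d 0 + d 1 ≤ F.totalDegree := by
  have := le_totalDegree hd
  rwa [Finsupp.sum_fintype _ _ (by simp), Fin.sum_univ_two] at this

lemma totalDegree_pcomp_le (F R S : Poly2) :
    (pcomp F R S).totalDegree ≤ F.totalDegree * degPair R S := by
  refine totalDegree_pcomp_le_of_weight (le_max_left _ _ : _ ≤ degPair R S)
    (le_max_right _ _ : _ ≤ degPair R S) fun d hd => ?_
  rw [← add_mul]
  exact Nat.mul_le_mul_right _ (add_le_totalDegree_of_mem_support hd)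

lemma weight_pair (d : Fin 2 →₀ ℕ) : Finsupp.weight ![p, q] d = d 0 * p + d 1 * q := by
  simp [Finsupp.weight_apply, Finsupp.sum_fintype]

lemma homogeneousComponent_pcomp (hP : P.totalDegree ≤ p) (hQ : Q.totalDegree ≤ q)
    (hG : ∀ d ∈ G.support, d 0 * p + d 1 * q ≤ N) :
    homogeneousComponent N (pcomp G P Q) =
      pcomp (weightedHomogeneousComponent ![p, q] N G)
        (homogeneousComponent p P) (homogeneousComponent q Q) := by
  classical
  rw [pcomp_eq_sum, map_sum, weightedHomogeneousComponent_apply, pcomp, map_sum,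
    Finset.sum_filter]
  refine Finset.sum_congr rfl fun d hd => ?_
  have hp := (totalDegree_pow P (d 0)).trans (Nat.mul_le_mul_left _ hP)
  have hq := (totalDegree_pow Q (d 1)).trans (Nat.mul_le_mul_left _ hQ)
  rw [homogeneousComponent_C_mul, ← pcomp, pcomp_monomial, weight_pair]
  split_ifs with h
  · rw [← h, homogeneousComponent_mul_of_le hp hq, homogeneousComponent_pow_of_le hP,
      homogeneousComponent_pow_of_le hQ]
  · rw [homogeneousComponent_eq_zero, mul_zero]
    exact lt_of_le_of_lt ((totalDegree_mul _ _).trans (add_le_add hp hq))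
      (lt_of_le_of_ne (hG d hd) h)

end HomogeneousComponents

section Derivatives

variable {F G P Q : Poly2}

lemma pderiv_pcomp (i : Fin 2) (G P Q : Poly2) :
    pderiv i (pcomp G P Q) =
      pcomp (pderiv 0 G) P Q * pderiv i P + pcomp (pderiv 1 G) P Q * pderiv i Q := by
  unfold pcomp
  induction G using MvPolynomial.induction_on with
  | C a => simp [algebraMap_eq]
  | add F G hF hG => simp only [map_add, hF, hG]; ring
  | mul_X F j hF =>
    simp only [map_mul, pderiv_mul, hF, map_add, aeval_X, pderiv_X]
    fin_cases j <;> simp <;> ring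

/-- The Jacobian determinant of a pair, as a polynomial. -/
def jacobianPoly (P Q : Poly2) : Poly2 := pderiv 0 P * pderiv 1 Q - pderiv 1 P * pderiv 0 Q

lemma jacobianPoly_pcomp (F G P Q : Poly2) :
    jacobianPoly (pcomp F P Q) (pcomp G P Q) =
      pcomp (jacobianPoly F G) P Q * jacobianPoly P Q := by
  simp only [jacobianPoly, pderiv_pcomp]
  simp only [pcomp, map_sub, map_mul]
  ring

lemma pcomp_X_zero (P Q : Poly2) : pcomp (X 0) P Q = P := by simp [pcomp]

lemma pcomp_X_one (P Q : Poly2) : pcomp (X 1) P Q = Q := by simp [pcomp]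

lemma jacobianPoly_right_pcomp (G P Q : Poly2) :
    jacobianPoly P (pcomp G P Q) = pcomp (pderiv 1 G) P Q * jacobianPoly P Q := by
  have := jacobianPoly_pcomp (X 0) G P Q
  rw [pcomp_X_zero] at this
  rw [this]
  simp [jacobianPoly]

lemma totalDegree_pderiv_add_one_le {i : Fin 2} (h : pderiv i F ≠ 0) :
    (pderiv i F).totalDegree + 1 ≤ F.totalDegree := by
  obtain ⟨d, hd, hdeg⟩ := exists_coeff_ne_zero_degree_eq h
  rw [coeff_pderiv] at hdeg
  have := le_totalDegree (mem_support_iff.2 (left_ne_zero_of_mul hdeg))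
  refine le_trans ?_ this
  change (pderiv i F).totalDegree + 1 ≤ (d + Finsupp.single i 1).degree
  rw [map_add, Finsupp.degree_single, hd]

lemma totalDegree_jacobianPoly_add_two_le (h : jacobianPoly P Q ≠ 0) :
    (jacobianPoly P Q).totalDegree + 2 ≤ P.totalDegree + Q.totalDegree := by
  have term : ∀ i j : Fin 2, pderiv i P * pderiv j Q ≠ 0 →
      (pderiv i P * pderiv j Q).totalDegree + 2 ≤ P.totalDegree + Q.totalDegree := by
    intro i j hij
    have h1 := totalDegree_pderiv_add_one_le (left_ne_zero_of_mul hij)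
    have h2 := totalDegree_pderiv_add_one_le (right_ne_zero_of_mul hij)
    have := totalDegree_mul (pderiv i P) (pderiv j Q)
    lia
  unfold jacobianPoly at h ⊢
  by_cases h1 : pderiv 0 P * pderiv 1 Q = 0
  · rw [h1, zero_sub] at h ⊢
    rw [totalDegree_neg]
    exact term 1 0 (neg_ne_zero.1 h)
  by_cases h2 : pderiv 1 P * pderiv 0 Q = 0
  · rw [h2, sub_zero] at h ⊢
    exact term 0 1 h
  have := totalDegree_sub (pderiv 0 P * pderiv 1 Q) (pderiv 1 P * pderiv 0 Q)
  have := term _ _ h1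
  have := term _ _ h2
  lia

lemma totalDegree_pcomp_pderiv_add_two_le (hJ : jacobianPoly P Q ≠ 0)
    (h : pcomp (pderiv 1 G) P Q ≠ 0) :
    (pcomp (pderiv 1 G) P Q).totalDegree + 2 ≤ P.totalDegree + (pcomp G P Q).totalDegree := by
  have hmul := jacobianPoly_right_pcomp G P Q
  have hdeg := totalDegree_mul_of_isDomain h hJ
  have hne : jacobianPoly P (pcomp G P Q) ≠ 0 := hmul ▸ mul_ne_zero h hJ
  have := totalDegree_jacobianPoly_add_two_le hne
  rw [hmul, hdeg] at this
  lia

lemma totalDegree_pcomp_iterate_pderiv_le (hJ : jacobianPoly P Q ≠ 0) (k : ℕ)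
    (h : pcomp ((pderiv 1)^[k] G) P Q ≠ 0) :
    (pcomp ((pderiv 1)^[k] G) P Q).totalDegree + 2 * k ≤
      k * P.totalDegree + (pcomp G P Q).totalDegree := by
  induction k with
  | zero => simp
  | succ k ih =>
    rw [Function.iterate_succ_apply'] at h ⊢
    have h' : pcomp ((pderiv 1)^[k] G) P Q ≠ 0 := by
      intro h0
      have := jacobianPoly_right_pcomp ((pderiv 1)^[k] G) P Q
      rw [h0, show jacobianPoly P 0 = 0 by simp [jacobianPoly]] at this
      exact mul_ne_zero h hJ this.symm
    have h1 := ih h'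
    have h2 := totalDegree_pcomp_pderiv_add_two_le hJ h
    rw [add_mul]
    lia

lemma weightedHomogeneousComponent_pderiv {p q N : ℕ} (G : Poly2) :
    weightedHomogeneousComponent ![p, q] N (pderiv 1 G) =
      pderiv 1 (weightedHomogeneousComponent ![p, q] (N + q) G) := by
  classical
  ext d
  simp only [coeff_weightedHomogeneousComponent, coeff_pderiv, weight_pair]
  simp [add_mul, ← add_assoc]

lemma weightedHomogeneousComponent_iterate_pderiv {p q N : ℕ} (k : ℕ) (G : Poly2) :
    weightedHomogeneousComponent ![p, q] N ((pderiv 1)^[k] G) =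
      (pderiv 1)^[k] (weightedHomogeneousComponent ![p, q] (N + k * q) G) := by
  induction k generalizing N with
  | zero => simp
  | succ k ih =>
    rw [Function.iterate_succ_apply', weightedHomogeneousComponent_pderiv, ih,
      Function.iterate_succ_apply']
    congr 4
    ring

end Derivatives

section VanishingOrder

lemma card_support_derivative_lt {g : Polynomial ℂ} (h0 : g.coeff 0 ≠ 0) :
    (Polynomial.derivative g).support.card < g.support.card := by
  have hsub : (Polynomial.derivative g).support.image Nat.succ ⊆ g.support.erase 0 := by
    intro j hj
    obtain ⟨i, hi, rfl⟩ := Finset.mem_image.1 hj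
    rw [Polynomial.mem_support_iff, Polynomial.coeff_derivative] at hi
    exact Finset.mem_erase.2
      ⟨Nat.succ_ne_zero i, Polynomial.mem_support_iff.2 (left_ne_zero_of_mul hi)⟩
  have hcard := Finset.card_le_card hsub
  rw [Finset.card_image_of_injective _ Nat.succ_injective] at hcard
  exact lt_of_le_of_lt hcard (Finset.card_erase_lt_of_mem (Polynomial.mem_support_iff.2 h0))

/-- A polynomial with `s` nonzero coefficients vanishes to order less than `s` at a nonzero point. -/
lemma rootMultiplicity_lt_card_support {β : ℂ} (hβ : β ≠ 0) (g : Polynomial ℂ) (hg : g ≠ 0) :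
    g.rootMultiplicity β < g.support.card := by
  induction hn : g.natDegree using Nat.strong_induction_on generalizing g with
  | _ n ih =>
  by_cases hroot : g.IsRoot β
  swap
  · rw [Polynomial.rootMultiplicity_eq_zero hroot]
    exact Finset.card_pos.2 (Polynomial.support_nonempty.2 hg)
  have hdeg : 0 < g.natDegree := by
    by_contra! hle
    rw [Polynomial.eq_C_of_natDegree_le_zero hle] at hroot hg
    simp only [Polynomial.IsRoot, Polynomial.eval_C] at hroot
    simp [hroot] at hg
  by_cases h0 : g.coeff 0 = 0
  · obtain ⟨f, rfl⟩ := Polynomial.X_dvd_iff.2 h0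
    have hf : f ≠ 0 := right_ne_zero_of_mul hg
    have hlt : f.natDegree < n := by
      rw [Polynomial.natDegree_X_mul hf] at hn
      lia
    have hX : (Polynomial.X : Polynomial ℂ).rootMultiplicity β = 0 :=
      Polynomial.rootMultiplicity_eq_zero (by simpa using hβ)
    rw [Polynomial.rootMultiplicity_mul hg, hX, zero_add]
    refine (ih _ hlt f hf rfl).trans_le ?_
    rw [← Finset.card_image_of_injective f.support Nat.succ_injective]
    refine Finset.card_le_card fun j hj => ?_
    obtain ⟨i, hi, rfl⟩ := Finset.mem_image.1 hj
    rw [Polynomial.mem_support_iff] at hi ⊢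
    rwa [Nat.succ_eq_add_one, Polynomial.coeff_X_mul]
  · have hder : Polynomial.derivative g ≠ 0 := fun h =>
      hdeg.ne' (Polynomial.derivative_eq_zero.1 h)
    have hlt := ih _ (hn ▸ Polynomial.natDegree_derivative_lt hdeg.ne') _ hder rfl
    rw [Polynomial.derivative_rootMultiplicity_of_root hroot] at hlt
    have := card_support_derivative_lt h0
    lia

lemma exists_mul_le_of_card_of_modEq {s : Finset ℕ} {m k : ℕ} (hk : k < s.card)
    (hs : ∀ i ∈ s, ∀ j ∈ s, i ≡ j [MOD m]) : ∃ j ∈ s, m * k ≤ j := by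
  rcases Nat.eq_zero_or_pos m with rfl | hm
  · obtain ⟨j, hj⟩ := Finset.card_pos.1 (lt_of_le_of_lt (Nat.zero_le k) hk)
    exact ⟨j, hj, by simp⟩
  by_contra! hlt
  have hmaps : Set.MapsTo (fun j => j / m) s (Finset.range k) := by
    intro j hj
    simpa using (Nat.div_lt_iff_lt_mul hm).2 (by rw [mul_comm]; exact hlt j hj)
  obtain ⟨i, hi, j, hj, hij, he⟩ :=
    Finset.exists_ne_map_eq_of_card_lt_of_maps_to (by simpa using hk) hmaps
  refine hij ?_
  replace he : i / m = j / m := he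
  rw [← Nat.div_add_mod i m, ← Nat.div_add_mod j m, hs i hi j hj, he]

end VanishingOrder

section WeightedForms

variable {H P Q : Poly2} {p q p' q' g N : ℕ}

/-- The restriction of a bivariate polynomial to the vertical line over `α`. -/
def restrictLine (α : ℂ) (H : Poly2) : Polynomial ℂ :=
  aeval ![Polynomial.C α, Polynomial.X] H

lemma restrictLine_eq_sum (α : ℂ) (H : Poly2) :
    restrictLine α H =
      ∑ d ∈ H.support, Polynomial.C (coeff d H * α ^ d 0) * Polynomial.X ^ d 1 := by
  rw [restrictLine, aeval_eq_eval₂Hom, coe_eval₂Hom, eval₂_eq']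
  refine Finset.sum_congr rfl fun d _ => ?_
  simp [Fin.prod_univ_two, mul_assoc]

lemma eval_restrictLine (α β : ℂ) (H : Poly2) :
    (restrictLine α H).eval β = eval ![α, β] H := by
  rw [restrictLine_eq_sum, eval_eq', Polynomial.eval_finsetSum]
  refine Finset.sum_congr rfl fun d _ => ?_
  simp [Fin.prod_univ_two, mul_assoc]

lemma derivative_restrictLine (α : ℂ) (H : Poly2) :
    Polynomial.derivative (restrictLine α H) = restrictLine α (pderiv 1 H) := by
  unfold restrictLine
  induction H using MvPolynomial.induction_on with
  | C a => simp
  | add F G hF hG => simp only [map_add, hF, hG]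
  | mul_X F j hF =>
    simp only [map_mul, pderiv_mul, Polynomial.derivative_mul, hF, map_add, aeval_X, pderiv_X]
    fin_cases j <;> simp

lemma iterate_derivative_restrictLine (α : ℂ) (k : ℕ) (H : Poly2) :
    Polynomial.derivative^[k] (restrictLine α H) = restrictLine α ((pderiv 1)^[k] H) := by
  induction k with
  | zero => rfl
  | succ k ih =>
    rw [Function.iterate_succ_apply', ih, derivative_restrictLine, Function.iterate_succ_apply']

lemma exists_mem_support_of_mem_support_restrictLine {α : ℂ} {j : ℕ}
    (hj : j ∈ (restrictLine α H).support) : ∃ d ∈ H.support, d 1 = j := by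
  by_contra! hne
  rw [Polynomial.mem_support_iff, restrictLine_eq_sum, Polynomial.finsetSum_coeff] at hj
  refine hj (Finset.sum_eq_zero fun d hd => ?_)
  rw [Polynomial.coeff_C_mul_X_pow, if_neg (hne d hd).symm]

lemma fin_two_finsupp_ext {d e : Fin 2 →₀ ℕ} (h0 : d 0 = e 0) (h1 : d 1 = e 1) : d = e := by
  ext i
  fin_cases i
  exacts [h0, h1]

lemma restrictLine_ne_zero {α : ℂ} (hα : α ≠ 0) (hp : 0 < p) (hH : H ≠ 0)
    (hw : ∀ d ∈ H.support, d 0 * p + d 1 * q = N) : restrictLine α H ≠ 0 := by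
  obtain ⟨d, hd⟩ := support_nonempty.2 hH
  intro h
  have hc := congrArg (fun f => Polynomial.coeff f (d 1)) h
  simp only [restrictLine_eq_sum, Polynomial.finsetSum_coeff, Polynomial.coeff_zero,
    Polynomial.coeff_C_mul_X_pow] at hc
  rw [Finset.sum_eq_single_of_mem d hd, if_pos rfl] at hc
  · exact mul_ne_zero (mem_support_iff.1 hd) (pow_ne_zero _ hα) hc
  · intro e he hne
    rw [if_neg]
    intro h1
    refine hne (fin_two_finsupp_ext ?_ h1.symm)
    have h2 := hw d hd
    have h3 := hw e he
    rw [← h1] at h3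
    exact Nat.eq_of_mul_eq_mul_right hp (by lia)

/-- A nonzero weighted homogeneous form has a vertical derivative which does not vanish at a given
pair of nonzero polynomials; the order of the first one is controlled by the weight. -/
lemma exists_pcomp_iterate_pderiv_ne_zero (hp : 0 < g * p') (hcop : p'.Coprime q')
    (hg : 0 < g) (hH : H ≠ 0)
    (hw : ∀ d ∈ H.support, d 0 * (g * p') + d 1 * (g * q') = N) (hP : P ≠ 0) (hQ : Q ≠ 0) :
    ∃ k, pcomp ((pderiv 1)^[k] H) P Q ≠ 0 ∧ k * (p' * (g * q')) ≤ N := by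
  have point : ∀ F : Poly2, F ≠ 0 → ∃ z : Fin 2 → ℂ, eval z F ≠ 0 := by
    intro F hF
    by_contra! h
    exact hF (MvPolynomial.funext fun z => by simpa using h z)
  have hex : ∃ k, pcomp ((pderiv 1)^[k] H) P Q ≠ 0 := by
    by_contra! hzero
    obtain ⟨z, hz⟩ := point _ (mul_ne_zero hP hQ)
    rw [map_mul] at hz
    have hg0 := restrictLine_ne_zero (left_ne_zero_of_mul hz) hp hH hw
    refine lt_irrefl ((restrictLine (eval z P) H).rootMultiplicity (eval z Q))
      ((Polynomial.lt_rootMultiplicity_iff_isRoot_iterate_derivative hg0).2 fun m _ => ?_)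
    rw [Polynomial.IsRoot, iterate_derivative_restrictLine, eval_restrictLine, ← eval_pcomp,
      hzero, map_zero]
  classical
  refine ⟨Nat.find hex, Nat.find_spec hex, ?_⟩
  set k := Nat.find hex with hk
  obtain ⟨z, hz⟩ := point _ (mul_ne_zero hP hQ)
  rw [map_mul] at hz
  have hα := left_ne_zero_of_mul hz
  have hβ := right_ne_zero_of_mul hz
  have hg0 := restrictLine_ne_zero hα hp hH hw
  have hmult : k ≤ (restrictLine (eval z P) H).rootMultiplicity (eval z Q) := by
    rcases Nat.eq_zero_or_pos k with h0 | hpos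
    · lia
    obtain ⟨k', hk'⟩ := Nat.exists_eq_succ_of_ne_zero hpos.ne'
    rw [hk', Nat.succ_le_iff,
      Polynomial.lt_rootMultiplicity_iff_isRoot_iterate_derivative hg0]
    intro m hm
    have hmk : m < Nat.find hex := by lia
    rw [Polynomial.IsRoot, iterate_derivative_restrictLine, eval_restrictLine, ← eval_pcomp,
      not_not.1 (Nat.find_min hex hmk), map_zero]
  have hcard := lt_of_le_of_lt hmult (rootMultiplicity_lt_card_support hβ _ hg0)
  obtain ⟨j, hj, hle⟩ := exists_mul_le_of_card_of_modEq (m := p') hcard (by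
    intro i hi j hj
    obtain ⟨d, hd, rfl⟩ := exists_mem_support_of_mem_support_restrictLine hi
    obtain ⟨e, he, rfl⟩ := exists_mem_support_of_mem_support_restrictLine hj
    have h1 : g * (d 0 * p' + d 1 * q') = g * (e 0 * p' + e 1 * q') := by
      linarith [hw d hd, hw e he]
    have h2 := Nat.eq_of_mul_eq_mul_left hg h1
    have h3 : d 1 * q' ≡ e 1 * q' [MOD p'] := by
      have h4 : (d 0 * p' + d 1 * q') % p' = (e 0 * p' + e 1 * q') % p' := by rw [h2]
      simpa [Nat.ModEq, Nat.add_mod] using h4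
    exact Nat.ModEq.cancel_right_of_coprime hcop h3)
  obtain ⟨d, hd, rfl⟩ := exists_mem_support_of_mem_support_restrictLine hj
  calc k * (p' * (g * q')) = p' * k * (g * q') := by ring
    _ ≤ d 1 * (g * q') := Nat.mul_le_mul_right _ hle
    _ ≤ N := by rw [← hw d hd]; exact Nat.le_add_left _ _

/-- If a nonzero weighted form of weights `(m * q, q)` vanishes at `(P, Q)`, then `P` is a multiple
of `Q ^ m`. -/
lemma exists_eq_C_mul_pow_of_pcomp_eq_zero {m : ℕ} (hq : 0 < q) (hH : H ≠ 0)
    (hw : ∀ d ∈ H.support, d 0 * (m * q) + d 1 * q = N) (hQ : Q ≠ 0)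
    (h : pcomp H P Q = 0) : ∃ c : ℂ, P = C c * Q ^ m := by
  classical
  set h1 : Polynomial ℂ := ∑ d ∈ H.support, Polynomial.monomial (d 0) (coeff d H) with hh1
  have hexp : ∀ d ∈ H.support, d 0 * m + d 1 = N / q := by
    intro d hd
    rw [← hw d hd]
    refine (Nat.div_eq_of_eq_mul_left hq ?_).symm
    ring
  have hne : h1 ≠ 0 := by
    obtain ⟨d, hd⟩ := support_nonempty.2 hH
    intro hz
    have hc := congrArg (fun f => Polynomial.coeff f (d 0)) hz
    simp only [hh1, Polynomial.finsetSum_coeff, Polynomial.coeff_zero,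
      Polynomial.coeff_monomial] at hc
    rw [Finset.sum_eq_single_of_mem d hd, if_pos rfl] at hc
    · exact mem_support_iff.1 hd hc
    · intro e he hed
      rw [if_neg]
      intro h0
      have := hexp d hd
      have := hexp e he
      rw [h0] at this
      exact hed (fin_two_finsupp_ext h0 (by lia))
  have hprod : Q * ∏ t ∈ h1.roots.toFinset, (P - C t * Q ^ m) = 0 := by
    refine MvPolynomial.funext fun z => ?_
    rw [map_mul, map_prod, map_zero]
    by_cases hz : eval z Q = 0
    · rw [hz, zero_mul]
    refine mul_eq_zero_of_right _ (Finset.prod_eq_zero (i := eval z P / eval z Q ^ m) ?_ ?_)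
    · rw [Multiset.mem_toFinset, Polynomial.mem_roots hne, Polynomial.IsRoot]
      have hev := congrArg (eval z) h
      rw [eval_pcomp, map_zero, eval_eq'] at hev
      have hscale : eval z Q ^ (N / q) * h1.eval (eval z P / eval z Q ^ m) = 0 := by
        rw [← hev, hh1, Polynomial.eval_finsetSum, Finset.mul_sum]
        refine Finset.sum_congr rfl fun d hd => ?_
        rw [Polynomial.eval_monomial, ← hexp d hd, Fin.prod_univ_two, div_pow, ← pow_mul,
          mul_comm m, pow_add]
        simp only [Matrix.cons_val_zero, Matrix.cons_val_one]
        field_simp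
      exact (mul_eq_zero.1 hscale).resolve_left (pow_ne_zero _ hz)
    · rw [map_sub, map_mul, eval_C, map_pow, div_mul_cancel₀ _ (pow_ne_zero _ hz), sub_self]
  obtain ⟨t, -, ht⟩ := Finset.prod_eq_zero_iff.1 ((mul_eq_zero.1 hprod).resolve_left hQ)
  exact ⟨t, sub_eq_zero.1 ht⟩

end WeightedForms

section LeadingForms

variable {G P Q P' Q' : Poly2}

lemma support_iterate_pderiv_weight_le {p q N : ℕ}
    (hG : ∀ d ∈ G.support, d 0 * p + d 1 * q ≤ N) (k : ℕ) :
    ∀ d ∈ ((pderiv 1)^[k] G).support, d 0 * p + d 1 * q + k * q ≤ N := by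
  induction k with
  | zero => simpa using hG
  | succ k ih =>
    intro d hd
    rw [Function.iterate_succ_apply', mem_support_iff, coeff_pderiv] at hd
    have := ih _ (mem_support_iff.2 (left_ne_zero_of_mul hd))
    simp only [Finsupp.add_apply, Finsupp.single_eq_same, add_mul] at this ⊢
    simp at this
    lia

lemma jacobianPoly_ne_zero (h1 : pcomp P' P Q = X 0) (h2 : pcomp Q' P Q = X 1) :
    jacobianPoly P Q ≠ 0 ∧ jacobianPoly P' Q' ≠ 0 := by
  have h := jacobianPoly_pcomp P' Q' P Q
  have hX : jacobianPoly (X 0) (X 1) = 1 := by simp [jacobianPoly]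
  rw [h1, h2, hX] at h
  refine ⟨fun h0 => ?_, fun h0 => ?_⟩ <;> simp [h0, pcomp] at h

lemma totalDegree_pos_of_jacobianPoly_ne_zero (h : jacobianPoly P Q ≠ 0) :
    0 < P.totalDegree ∧ 0 < Q.totalDegree := by
  constructor <;> by_contra! h0 <;> apply h <;>
    rw [totalDegree_eq_zero_iff_eq_C.1 (Nat.le_zero.1 h0)] <;> simp [jacobianPoly]

lemma exists_weighted_leading_form (P Q : Poly2) (hG : G ≠ 0) :
    ∃ N, (∀ d ∈ G.support, d 0 * P.totalDegree + d 1 * Q.totalDegree ≤ N) ∧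
      weightedHomogeneousComponent ![P.totalDegree, Q.totalDegree] N G ≠ 0 := by
  classical
  obtain ⟨d, hd, hmax⟩ := Finset.exists_max_image G.support
    (fun d => d 0 * P.totalDegree + d 1 * Q.totalDegree) (support_nonempty.2 hG)
  refine ⟨_, hmax, fun h => ?_⟩
  have := congrArg (coeff d) h
  rw [coeff_weightedHomogeneousComponent, if_pos (weight_pair d)] at this
  exact mem_support_iff.1 hd (by simpa using this)

lemma weight_eq_of_mem_support {p q N : ℕ} :
    ∀ d ∈ (weightedHomogeneousComponent ![p, q] N G).support, d 0 * p + d 1 * q = N := by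
  classical
  intro d hd
  rw [mem_support_iff, coeff_weightedHomogeneousComponent, weight_pair] at hd
  exact (ite_ne_right_iff.1 hd).1

/-- If `P, Q` generate the polynomial ring and are not both of degree one, one of the components of
the inverse has a weighted leading form vanishing at the leading forms of `P` and `Q`. -/
lemma exists_leading_form_pcomp_eq_zero (h1 : pcomp P' P Q = X 0) (h2 : pcomp Q' P Q = X 1)
    (hdeg : 2 < P.totalDegree + Q.totalDegree) :
    ∃ G N, (pcomp G P Q).totalDegree = 1 ∧
      (∀ d ∈ G.support, d 0 * P.totalDegree + d 1 * Q.totalDegree ≤ N) ∧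
      weightedHomogeneousComponent ![P.totalDegree, Q.totalDegree] N G ≠ 0 ∧
      pcomp (weightedHomogeneousComponent ![P.totalDegree, Q.totalDegree] N G)
        (homogeneousComponent P.totalDegree P) (homogeneousComponent Q.totalDegree Q) = 0 := by
  by_contra! hne
  have key : ∀ G, (pcomp G P Q).totalDegree = 1 →
      ∀ d ∈ G.support, d 0 * P.totalDegree + d 1 * Q.totalDegree ≤ 1 := by
    intro G hG d hd
    have hG0 : G ≠ 0 := by rintro rfl; simp at hd
    obtain ⟨N, hN, hH⟩ := exists_weighted_leading_form P Q hG0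
    have hpc := hne G N hG hN hH
    rw [← homogeneousComponent_pcomp le_rfl le_rfl hN] at hpc
    have := le_totalDegree_of_homogeneousComponent_ne_zero hpc
    exact (hN d hd).trans (hG ▸ this)
  have hd1 := key P' (by rw [h1, totalDegree_X])
  have hd2 := key Q' (by rw [h2, totalDegree_X])
  have hJ := (jacobianPoly_ne_zero h1 h2).2
  obtain ⟨i, hi⟩ : ∃ i : Fin 2, 2 ≤ ![P.totalDegree, Q.totalDegree] i := by
    by_contra! h
    have h0 := h 0
    have h1 := h 1
    simp at h0 h1
    lia
  have hder : ∀ G : Poly2, (∀ d ∈ G.support, d 0 * P.totalDegree + d 1 * Q.totalDegree ≤ 1) →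
      pderiv i G = 0 := by
    intro G hG
    ext d
    rw [coeff_pderiv, coeff_zero]
    by_contra h
    have hle := hG _ (mem_support_iff.2 (left_ne_zero_of_mul h))
    fin_cases i <;> simp [add_mul] at hle hi <;> lia
  apply hJ
  have e1 := hder P' hd1
  have e2 := hder Q' hd2
  unfold jacobianPoly
  fin_cases i <;> simp at e1 e2 <;> simp [e1, e2]

/-- The degrees of the components of a plane automorphism divide one another. -/
lemma totalDegree_dvd_or_dvd (h1 : pcomp P' P Q = X 0) (h2 : pcomp Q' P Q = X 1)
    (hdeg : 2 < P.totalDegree + Q.totalDegree) :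
    P.totalDegree ∣ Q.totalDegree ∨ Q.totalDegree ∣ P.totalDegree := by
  obtain ⟨G, N, hG1, hN, hH, hzero⟩ := exists_leading_form_pcomp_eq_zero h1 h2 hdeg
  have hJ := (jacobianPoly_ne_zero h1 h2).1
  obtain ⟨hp, hq⟩ := totalDegree_pos_of_jacobianPoly_ne_zero hJ
  have hP0 : P ≠ 0 := by rintro rfl; simp at hp
  have hQ0 : Q ≠ 0 := by rintro rfl; simp at hq
  obtain ⟨g, p', q', hg, hcop, ep, eq⟩ := Nat.exists_coprime' (Nat.gcd_pos_of_pos_left _ hp)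
    (m := P.totalDegree) (n := Q.totalDegree)
  rw [mul_comm] at ep eq
  obtain ⟨k, hk, hkN⟩ := exists_pcomp_iterate_pderiv_ne_zero (N := N) (g := g) (by rwa [← ep]) hcop
    hg hH (by rw [← ep, ← eq]; exact weight_eq_of_mem_support)
    (homogeneousComponent_totalDegree_ne_zero hP0) (homogeneousComponent_totalDegree_ne_zero hQ0)
  have hk0 : k ≠ 0 := by
    rintro rfl
    exact hk hzero
  by_contra! hndvd
  have hp2 : 2 ≤ p' := by
    by_contra! h
    have : p' ≠ 0 := by rintro rfl; lia
    obtain rfl : p' = 1 := by lia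
    exact hndvd.1 (ep ▸ eq ▸ ⟨q', by ring⟩)
  have hq2 : 2 ≤ q' := by
    by_contra! h
    have : q' ≠ 0 := by rintro rfl; lia
    obtain rfl : q' = 1 := by lia
    exact hndvd.2 (ep ▸ eq ▸ ⟨p', by ring⟩)
  have hsum : p' + q' ≤ p' * q' := by nlinarith
  have hbig : k * P.totalDegree + k * Q.totalDegree ≤ N := by
    refine le_trans ?_ hkN
    rw [ep, eq]
    calc k * (g * p') + k * (g * q') = (k * g) * (p' + q') := by ring
      _ ≤ (k * g) * (p' * q') := Nat.mul_le_mul_left _ hsum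
      _ = _ := by ring
  obtain ⟨M, rfl⟩ : ∃ M, N = M + k * Q.totalDegree := ⟨N - k * Q.totalDegree, by lia⟩
  have hbound : ∀ d ∈ ((pderiv 1)^[k] G).support,
      d 0 * P.totalDegree + d 1 * Q.totalDegree ≤ M := fun d hd => by
    have := support_iterate_pderiv_weight_le hN k d hd
    lia
  rw [← weightedHomogeneousComponent_iterate_pderiv,
    ← homogeneousComponent_pcomp le_rfl le_rfl hbound] at hk
  have hM := le_totalDegree_of_homogeneousComponent_ne_zero hk
  have hF : pcomp ((pderiv 1)^[k] G) P Q ≠ 0 := by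
    intro h
    rw [h, map_zero] at hk
    exact hk rfl
  have hchain := totalDegree_pcomp_iterate_pderiv_le hJ k hF
  lia

/-- The leading form of the component of larger degree of a plane automorphism is a multiple of a
power of the leading form of the other one. -/
lemma exists_leading_form_eq (h1 : pcomp P' P Q = X 0) (h2 : pcomp Q' P Q = X 1)
    (hdeg : 2 < P.totalDegree + Q.totalDegree) (hle : Q.totalDegree ≤ P.totalDegree) :
    ∃ (m : ℕ) (c : ℂ), P.totalDegree = m * Q.totalDegree ∧
      homogeneousComponent P.totalDegree P = C c * homogeneousComponent Q.totalDegree Q ^ m := by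
  obtain ⟨hp, hq⟩ := totalDegree_pos_of_jacobianPoly_ne_zero (jacobianPoly_ne_zero h1 h2).1
  have hQ0 : Q ≠ 0 := by rintro rfl; simp at hq
  have hdvd : Q.totalDegree ∣ P.totalDegree := by
    rcases totalDegree_dvd_or_dvd h1 h2 hdeg with h | h
    · rw [le_antisymm hle (Nat.le_of_dvd hq h)]
    · exact h
  obtain ⟨m, hm⟩ := hdvd
  rw [mul_comm] at hm
  obtain ⟨G, N, -, -, hH, hzero⟩ := exists_leading_form_pcomp_eq_zero h1 h2 hdeg
  obtain ⟨c, hc⟩ := exists_eq_C_mul_pow_of_pcomp_eq_zero (m := m) hq hH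
    (by rw [← hm]; exact weight_eq_of_mem_support)
    (homogeneousComponent_totalDegree_ne_zero hQ0) hzero
  exact ⟨m, c, hm, hc⟩

/-- Subtracting a multiple of a power of the component of smaller degree lowers the degree. -/
lemma exists_totalDegree_sub_lt (h1 : pcomp P' P Q = X 0) (h2 : pcomp Q' P Q = X 1)
    (hdeg : 2 < P.totalDegree + Q.totalDegree) (hle : Q.totalDegree ≤ P.totalDegree) :
    ∃ (m : ℕ) (c : ℂ), (P - C c * Q ^ m).totalDegree < P.totalDegree := by
  obtain ⟨hp, -⟩ := totalDegree_pos_of_jacobianPoly_ne_zero (jacobianPoly_ne_zero h1 h2).1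
  obtain ⟨m, c, hm, hc⟩ := exists_leading_form_eq h1 h2 hdeg hle
  refine ⟨m, c, totalDegree_lt_of_homogeneousComponent_eq_zero hp ?_ ?_⟩
  · refine (totalDegree_sub _ _).trans (max_le le_rfl ?_)
    refine (totalDegree_mul _ _).trans ?_
    rw [totalDegree_C, zero_add, hm]
    exact totalDegree_pow _ _
  · rw [map_sub, hc, homogeneousComponent_C_mul, hm, homogeneousComponent_pow_of_le le_rfl,
      sub_self]

end LeadingForms

section PolynomialMaps

/-- A polynomial self-map of the affine plane. -/
@[ext]
structure PolyMap where
  fst : Poly2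
  snd : Poly2

lemma pcomp_pcomp (F P Q R S : Poly2) :
    pcomp (pcomp F P Q) R S = pcomp F (pcomp P R S) (pcomp Q R S) :=
  MvPolynomial.funext fun z => by simp only [eval_pcomp]

lemma pcomp_X_X (F : Poly2) : pcomp F (X 0) (X 1) = F := by
  refine MvPolynomial.funext fun z => ?_
  rw [eval_pcomp, eval_X, eval_X]
  congr 2
  ext i
  fin_cases i <;> rfl

namespace PolyMap

/-- Polynomial maps form a monoid under composition. -/
instance : Monoid PolyMap where
  mul f g := ⟨pcomp f.fst g.fst g.snd, pcomp f.snd g.fst g.snd⟩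
  one := ⟨X 0, X 1⟩
  mul_assoc f g h := PolyMap.ext (pcomp_pcomp _ _ _ _ _) (pcomp_pcomp _ _ _ _ _)
  one_mul f := PolyMap.ext (pcomp_X_zero _ _) (pcomp_X_one _ _)
  mul_one f := PolyMap.ext (pcomp_X_X _) (pcomp_X_X _)

variable {f g : PolyMap}

lemma mul_fst (f g : PolyMap) : (f * g).fst = pcomp f.fst g.fst g.snd := rfl

lemma mul_snd (f g : PolyMap) : (f * g).snd = pcomp f.snd g.fst g.snd := rfl

lemma one_fst : (1 : PolyMap).fst = X 0 := rfl

lemma one_snd : (1 : PolyMap).snd = X 1 := rfl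

/-- The degree of a polynomial map. -/
def deg (f : PolyMap) : ℕ := degPair f.fst f.snd

lemma deg_mul_le (f g : PolyMap) : (f * g).deg ≤ f.deg * g.deg :=
  max_le
    ((totalDegree_pcomp_le _ _ _).trans (Nat.mul_le_mul_right _ (le_max_left _ _)))
    ((totalDegree_pcomp_le _ _ _).trans (Nat.mul_le_mul_right _ (le_max_right _ _)))

lemma deg_one : (1 : PolyMap).deg = 1 := by
  simp [deg, degPair, one_fst, one_snd]

/-- `f` has the form `(a x + p(y), b y + c)` with `p` of degree at most `D`. -/
def IsElementary (D : ℕ) (f : PolyMap) : Prop :=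
  ∃ (a b c : ℂ) (p : Polynomial ℂ), p.natDegree ≤ D ∧
    f.fst = C a * X 0 + Polynomial.aeval (X 1) p ∧ f.snd = C b * X 1 + C c

lemma _root_.pcomp_aeval (p : Polynomial ℂ) (F R S : Poly2) :
    pcomp (Polynomial.aeval F p) R S = Polynomial.aeval (pcomp F R S) p :=
  (Polynomial.aeval_algHom_apply (MvPolynomial.aeval ![R, S]) F p).symm

lemma _root_.totalDegree_aeval_le {S : Poly2} {n d : ℕ} {p : Polynomial ℂ} (hp : p.natDegree ≤ d)
    (hS : S.totalDegree ≤ n) : (Polynomial.aeval S p).totalDegree ≤ d * n := by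
  rw [Polynomial.aeval_eq_sum_range' (Nat.lt_succ_of_le hp)]
  refine totalDegree_finsetSum_le fun i hi => (totalDegree_smul_le _ _).trans ?_
  exact (totalDegree_pow _ _).trans
    (Nat.mul_le_mul (Nat.lt_succ_iff.1 (Finset.mem_range.1 hi)) hS)

lemma _root_.homogeneousComponent_aeval {S : Poly2} {n d : ℕ} {p : Polynomial ℂ} (hn : 1 ≤ n)
    (hp : p.natDegree ≤ d) (hS : S.totalDegree ≤ n) :
    homogeneousComponent (d * n) (Polynomial.aeval S p) =
      C (p.coeff d) * homogeneousComponent n S ^ d := by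
  rw [Polynomial.aeval_eq_sum_range' (Nat.lt_succ_of_le hp), map_sum, Finset.sum_range_succ,
    Finset.sum_eq_zero, zero_add]
  · rw [smul_eq_C_mul, homogeneousComponent_C_mul, homogeneousComponent_pow_of_le hS]
  · intro i hi
    refine homogeneousComponent_eq_zero _ _ ((totalDegree_smul_le _ _).trans_lt ?_)
    refine ((totalDegree_pow _ _).trans (Nat.mul_le_mul_left i hS)).trans_lt ?_
    exact Nat.mul_lt_mul_of_pos_right (Finset.mem_range.1 hi) hn

lemma IsElementary.mul {D E : ℕ} (hf : f.IsElementary D) (hg : g.IsElementary E) :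
    (f * g).IsElementary (max D E) := by
  obtain ⟨a, b, c, p, hp, hf1, hf2⟩ := hf
  obtain ⟨a', b', c', p', hp', hg1, hg2⟩ := hg
  refine ⟨a * a', b * b', b * c' + c,
    Polynomial.C a * p' + p.comp (Polynomial.C b' * Polynomial.X + Polynomial.C c'), ?_, ?_, ?_⟩
  · refine (Polynomial.natDegree_add_le _ _).trans (max_le ?_ ?_)
    · exact (Polynomial.natDegree_C_mul_le _ _).trans (hp'.trans (le_max_right _ _))
    · refine Polynomial.natDegree_comp_le.trans (le_trans ?_ (hp.trans (le_max_left _ _)))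
      exact (Nat.mul_le_mul_left _ Polynomial.natDegree_linear_le).trans (mul_one _).le
  · rw [mul_fst, hf1]
    have : pcomp (C a * X 0 + Polynomial.aeval (X 1) p) g.fst g.snd =
        C a * g.fst + Polynomial.aeval g.snd p := by
      rw [← pcomp_X_one g.fst g.snd, ← pcomp_aeval]
      simp [pcomp]
    rw [this, hg1, hg2]
    simp [Polynomial.aeval_comp, algebraMap_eq]
    ring
  · rw [mul_snd, hf2]
    have : pcomp (C b * X 1 + C c) g.fst g.snd = C b * g.snd + C c := by simp [pcomp]
    rw [this, hg2]
    simp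
    ring

lemma isElementary_one (D : ℕ) : (1 : PolyMap).IsElementary D :=
  ⟨1, 1, 0, 0, by simp, by simp [one_fst], by simp [one_snd]⟩

lemma IsElementary.pow {D : ℕ} (hf : f.IsElementary D) (n : ℕ) : (f ^ n).IsElementary D := by
  induction n with
  | zero => exact isElementary_one D
  | succ n ih => simpa [pow_succ] using ih.mul hf

lemma _root_.totalDegree_linear_le (a b c : ℂ) :
    (C a * X 0 + C b * X 1 + C c : Poly2).totalDegree ≤ 1 := by
  have term : ∀ (a : ℂ) (i : Fin 2), (C a * X i : Poly2).totalDegree ≤ 1 := fun a i =>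
    (totalDegree_mul _ _).trans (by simp)
  refine (totalDegree_add _ _).trans (max_le ?_ (by simp))
  exact (totalDegree_add _ _).trans (max_le (term a 0) (term b 1))

lemma _root_.exists_eq_linear {F : Poly2} (hF : F.totalDegree ≤ 1) :
    ∃ a b c : ℂ, F = C a * X 0 + C b * X 1 + C c := by
  classical
  refine ⟨coeff (Finsupp.single 0 1) F, coeff (Finsupp.single 1 1) F, coeff 0 F, ?_⟩
  ext d
  simp only [coeff_add, coeff_C_mul, coeff_X, coeff_C]
  by_cases hd : d.degree ≤ 1
  · rw [Finsupp.degree_eq_sum, Fin.sum_univ_two] at hd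
    have hcases : d = 0 ∨ d = Finsupp.single 0 1 ∨ d = Finsupp.single 1 1 := by
      by_cases h0 : d 0 = 0
      · by_cases h1 : d 1 = 0
        · exact Or.inl (fin_two_finsupp_ext (by simpa using h0) (by simpa using h1))
        · exact Or.inr (Or.inr (fin_two_finsupp_ext (by simpa using h0) (by simp; lia)))
      · exact Or.inr (Or.inl (fin_two_finsupp_ext (by simp; lia) (by simp; lia)))
    have h0 : ∀ i : Fin 2, (0 : Fin 2 →₀ ℕ) ≠ Finsupp.single i 1 := fun i h => by
      simpa using DFunLike.congr_fun h i
    have h01 : (Finsupp.single 0 1 : Fin 2 →₀ ℕ) ≠ Finsupp.single 1 1 := fun h => by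
      simpa using DFunLike.congr_fun h 0
    rcases hcases with rfl | rfl | rfl
    · simp
    · simp [h01.symm, h0]
    · simp [h01, h0]
  · push Not at hd
    rw [coeff_eq_zero_of_totalDegree_lt (lt_of_le_of_lt hF hd)]
    have ne : ∀ e : Fin 2 →₀ ℕ, e.degree ≤ 1 → e ≠ d := fun e he h => by
      rw [h] at he
      lia
    simp [ne (Finsupp.single 0 1) (by simp), ne (Finsupp.single 1 1) (by simp), ne 0 (by simp)]

lemma IsElementary.deg_le {D : ℕ} (hf : f.IsElementary D) : f.deg ≤ max 1 D := by
  obtain ⟨a, b, c, p, hp, hf1, hf2⟩ := hf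
  refine max_le ?_ ?_
  · rw [hf1]
    refine (totalDegree_add _ _).trans (max_le ?_ ?_)
    · exact (by simpa using totalDegree_linear_le a 0 0 : _ ≤ 1).trans (le_max_left _ _)
    · have := totalDegree_aeval_le hp (totalDegree_X (R := ℂ) (1 : Fin 2)).le
      rw [mul_one] at this
      exact this.trans (le_max_right _ _)
  · rw [hf2]
    exact (by simpa using totalDegree_linear_le 0 b c : _ ≤ 1).trans (le_max_left _ _)

end PolyMap

/-- The group of polynomial automorphisms of the affine plane. -/
abbrev PolyAut : Type := PolyMapˣ

namespace PolyAut

lemma pcomp_inv (u : PolyAut) :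
    pcomp u.val.fst u⁻¹.val.fst u⁻¹.val.snd = X 0 ∧
      pcomp u.val.snd u⁻¹.val.fst u⁻¹.val.snd = X 1 :=
  ⟨congrArg PolyMap.fst u.mul_inv, congrArg PolyMap.snd u.mul_inv⟩

lemma jacobianPoly_ne_zero (u : PolyAut) : jacobianPoly u.val.fst u.val.snd ≠ 0 :=
  (_root_.jacobianPoly_ne_zero (pcomp_inv u).1 (pcomp_inv u).2).2

lemma one_le_deg (u : PolyAut) : 1 ≤ u.val.deg := by
  have := PolyMap.deg_mul_le u.val u⁻¹.val
  rw [u.mul_inv, PolyMap.deg_one] at this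
  exact Nat.pos_of_ne_zero fun h => by simp [h] at this

lemma deg_inv_le_one {u : PolyAut} (hu : u.val.deg ≤ 1) : u⁻¹.val.deg ≤ 1 := by
  obtain ⟨a, b, e, h1⟩ := exists_eq_linear ((le_max_left _ _).trans hu)
  obtain ⟨c, d, f, h2⟩ := exists_eq_linear ((le_max_right _ _).trans hu)
  have hJ := jacobianPoly_ne_zero u
  obtain ⟨e1, e2⟩ := pcomp_inv u
  rw [h1] at e1 hJ
  rw [h2] at e2 hJ
  have hdet : a * d - b * c ≠ 0 := by
    intro h
    apply hJ
    have : jacobianPoly (C a * X 0 + C b * X 1 + C e) (C c * X 0 + C d * X 1 + C f) =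
        C (a * d - b * c) := by
      simp [jacobianPoly, pderiv_X]
    rw [this, h, C_0]
  set P := u⁻¹.val.fst with hP
  set Q := u⁻¹.val.snd with hQ
  have f1 : C a * P + C b * Q + C e = X 0 := by simpa [pcomp] using e1
  have f2 : C c * P + C d * Q + C f = X 1 := by simpa [pcomp] using e2
  have hinv : C (a * d - b * c)⁻¹ * (C a * C d - C b * C c) = (1 : Poly2) := by
    rw [← C_mul, ← C_mul, ← C_sub, ← C_mul, inv_mul_cancel₀ hdet, C_1]
  refine max_le ?_ ?_
  · have : P = C ((a * d - b * c)⁻¹ * d) * X 0 + C (-(a * d - b * c)⁻¹ * b) * X 1 +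
        C ((a * d - b * c)⁻¹ * (b * f - d * e)) := by
      rw [← f1, ← f2]
      simp only [C_mul, C_sub, C_neg]
      linear_combination (-P) * hinv
    rw [← hP, this]
    exact totalDegree_linear_le _ _ _
  · have : Q = C (-(a * d - b * c)⁻¹ * c) * X 0 + C ((a * d - b * c)⁻¹ * a) * X 1 +
        C ((a * d - b * c)⁻¹ * (c * e - a * f)) := by
      rw [← f1, ← f2]
      simp only [C_mul, C_sub, C_neg]
      linear_combination (-Q) * hinv
    rw [← hQ, this]
    exact totalDegree_linear_le _ _ _

lemma isElementary_inv {u : PolyAut} {D : ℕ} (hu : u.val.IsElementary D) :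
    u⁻¹.val.IsElementary D := by
  obtain ⟨a, b, c, p, hp, h1, h2⟩ := hu
  have hJ := jacobianPoly_ne_zero u
  obtain ⟨e1, e2⟩ := pcomp_inv u
  rw [h1] at e1 hJ
  rw [h2] at e2 hJ
  have hp0 : pderiv 0 (Polynomial.aeval (X 1 : Poly2) p) = 0 := by
    rw [Derivation.map_aeval]
    simp
  have hab : a * b ≠ 0 := by
    intro h
    apply hJ
    simp only [jacobianPoly, map_add, pderiv_C_mul, pderiv_C, hp0]
    simp [← C_mul, h]
  have ha := left_ne_zero_of_mul hab
  have hb := right_ne_zero_of_mul hab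
  set P := u⁻¹.val.fst with hP
  set Q := u⁻¹.val.snd with hQ
  have f1 : C a * P + Polynomial.aeval Q p = X 0 := by
    rw [← pcomp_X_one P Q, ← pcomp_aeval, ← e1]
    simp [pcomp]
  have f2 : C b * Q + C c = X 1 := by simpa [pcomp] using e2
  have hai : C a⁻¹ * C a = (1 : Poly2) := by rw [← C_mul, inv_mul_cancel₀ ha, C_1]
  have hbi : C b⁻¹ * C b = (1 : Poly2) := by rw [← C_mul, inv_mul_cancel₀ hb, C_1]
  have hQe : Q = C b⁻¹ * X 1 + C (-(b⁻¹ * c)) := by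
    rw [← f2]
    simp only [C_mul, C_neg]
    linear_combination (-Q) * hbi
  refine ⟨a⁻¹, b⁻¹, -(b⁻¹ * c), Polynomial.C (-a⁻¹) *
    p.comp (Polynomial.C b⁻¹ * Polynomial.X + Polynomial.C (-(b⁻¹ * c))), ?_, ?_, hQe⟩
  · refine (Polynomial.natDegree_C_mul_le _ _).trans ?_
    refine Polynomial.natDegree_comp_le.trans (le_trans ?_ hp)
    exact (Nat.mul_le_mul_left _ Polynomial.natDegree_linear_le).trans (mul_one _).le
  · have : Polynomial.aeval (X 1 : Poly2)
        (p.comp (Polynomial.C b⁻¹ * Polynomial.X + Polynomial.C (-(b⁻¹ * c)))) =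
          Polynomial.aeval Q p := by
      rw [hQe, Polynomial.aeval_comp]
      simp [algebraMap_eq]
    rw [map_mul, this, Polynomial.aeval_C, algebraMap_eq, ← f1, ← hP, C_neg]
    linear_combination (-P) * hai

/-- The group of affine automorphisms. -/
def affine : Subgroup PolyAut where
  carrier := {u | u.val.deg ≤ 1}
  mul_mem' {u v} hu hv := (PolyMap.deg_mul_le u.val v.val).trans (Nat.mul_le_mul hu hv)
  one_mem' := PolyMap.deg_one.le
  inv_mem' hu := deg_inv_le_one hu

/-- The group of elementary automorphisms `(a x + p(y), b y + c)`. -/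
def elementary : Subgroup PolyAut where
  carrier := {u | ∃ D, u.val.IsElementary D}
  mul_mem' := fun ⟨_, hu⟩ ⟨_, hv⟩ => ⟨_, hu.mul hv⟩
  one_mem' := ⟨0, PolyMap.isElementary_one 0⟩
  inv_mem' := fun ⟨D, hu⟩ => ⟨D, isElementary_inv hu⟩

lemma exists_deg_pow_le {u : PolyAut} (hu : u ∈ affine ∨ u ∈ elementary) :
    ∃ D, ∀ n : ℕ, (u ^ n).val.deg ≤ D := by
  rcases hu with hu | ⟨D, hu⟩
  · exact ⟨1, fun n => affine.pow_mem hu n⟩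
  · refine ⟨max 1 D, fun n => ?_⟩
    rw [Units.val_pow_eq_pow_val]
    exact (hu.pow n).deg_le

lemma exists_deg_pow_le_of_isConj {u v : PolyAut} (h : IsConj u v)
    (hv : v ∈ affine ∨ v ∈ elementary) : ∃ D, ∀ n : ℕ, (u ^ n).val.deg ≤ D := by
  obtain ⟨D, hD⟩ := exists_deg_pow_le hv
  obtain ⟨c, hc⟩ := isConj_iff.1 h.symm
  refine ⟨c.val.deg * D * c⁻¹.val.deg, fun n => ?_⟩
  rw [← hc, conj_pow]
  exact (PolyMap.deg_mul_le (c * v ^ n).val c⁻¹.val).trans (Nat.mul_le_mul_right _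
    ((PolyMap.deg_mul_le c.val (v ^ n).val).trans (Nat.mul_le_mul_left _ (hD n))))

/-- The automorphism exchanging the coordinates. -/
def swap : PolyAut where
  val := ⟨X 1, X 0⟩
  inv := ⟨X 1, X 0⟩
  val_inv := PolyMap.ext (pcomp_X_one _ _) (pcomp_X_zero _ _)
  inv_val := PolyMap.ext (pcomp_X_one _ _) (pcomp_X_zero _ _)

lemma swap_mem_affine : swap ∈ affine := by
  change degPair (X 1) (X 0) ≤ 1
  simp [degPair]

/-- The shear `(x + c y ^ m, y)`. -/
def shear (c : ℂ) (m : ℕ) : PolyAut where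
  val := ⟨X 0 + C c * X 1 ^ m, X 1⟩
  inv := ⟨X 0 - C c * X 1 ^ m, X 1⟩
  val_inv := PolyMap.ext (by simp [PolyMap.mul_fst, PolyMap.one_fst, pcomp]) (pcomp_X_one _ _)
  inv_val := PolyMap.ext (by simp [PolyMap.mul_fst, PolyMap.one_fst, pcomp]) (pcomp_X_one _ _)

lemma shear_mem_elementary (c : ℂ) (m : ℕ) : shear c m ∈ elementary :=
  ⟨m, 1, 1, 0, Polynomial.C c * Polynomial.X ^ m, Polynomial.natDegree_C_mul_X_pow_le c m,
    by simp [shear, algebraMap_eq], by simp [shear]⟩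

/-- A word is a list of pairs of an elementary and an affine automorphism. -/
def IsWord (l : List (PolyAut × PolyAut)) : Prop := ∀ x ∈ l, x.1 ∈ elementary ∧ x.2 ∈ affine

/-- The automorphism spelled by a list of pairs. -/
def wordProd (l : List (PolyAut × PolyAut)) : PolyAut := (l.map fun x => x.1 * x.2).prod

lemma wordProd_cons (x : PolyAut × PolyAut) (l : List (PolyAut × PolyAut)) :
    wordProd (x :: l) = x.1 * x.2 * wordProd l := by
  simp [wordProd]

lemma wordProd_append (l l' : List (PolyAut × PolyAut)) :
    wordProd (l ++ l') = wordProd l * wordProd l' := by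
  simp [wordProd]

lemma IsWord.cons {x : PolyAut × PolyAut} {l : List (PolyAut × PolyAut)} (h1 : x.1 ∈ elementary)
    (h2 : x.2 ∈ affine) (hl : IsWord l) : IsWord (x :: l) :=
  List.forall_mem_cons.2 ⟨⟨h1, h2⟩, hl⟩

lemma pcomp_inv' (u : PolyAut) :
    pcomp u⁻¹.val.fst u.val.fst u.val.snd = X 0 ∧
      pcomp u⁻¹.val.snd u.val.fst u.val.snd = X 1 :=
  ⟨congrArg PolyMap.fst u.inv_mul, congrArg PolyMap.snd u.inv_mul⟩

/-- Jung's theorem: plane automorphisms are products of elementary and affine ones. -/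
theorem exists_wordProd_eq (u : PolyAut) : ∃ l, IsWord l ∧ wordProd l = u := by
  have main : ∀ (n : ℕ) (u : PolyAut), u.val.fst.totalDegree + u.val.snd.totalDegree = n →
      u.val.snd.totalDegree ≤ u.val.fst.totalDegree → ∃ l, IsWord l ∧ wordProd l = u := by
    intro n
    induction n using Nat.strong_induction_on with
    | _ n ih =>
    intro u hn hle
    by_cases hdeg : n ≤ 2
    · obtain ⟨-, h2⟩ := totalDegree_pos_of_jacobianPoly_ne_zero (jacobianPoly_ne_zero u)
      have hu : degPair u.val.fst u.val.snd ≤ 1 := max_le (by lia) (by lia)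
      exact ⟨[(1, u)], .cons elementary.one_mem hu (by simp [IsWord]), by simp [wordProd]⟩
    · push Not at hdeg
      obtain ⟨m, c, hlt⟩ := exists_totalDegree_sub_lt (pcomp_inv' u).1 (pcomp_inv' u).2
        (by lia) hle
      set v := (shear c m)⁻¹ * u with hv
      have hv1 : v.val.fst = u.val.fst - C c * u.val.snd ^ m := by
        change pcomp (X 0 - C c * X 1 ^ m) u.val.fst u.val.snd = _
        simp [pcomp]
      have hv2 : v.val.snd = u.val.snd := pcomp_X_one _ _
      have huv : u = shear c m * v := by rw [hv]; group
      by_cases hcmp : v.val.snd.totalDegree ≤ v.val.fst.totalDegree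
      · obtain ⟨l, hl, hlv⟩ := ih _ (by rw [hv1, hv2, ← hn]; lia) v rfl hcmp
        exact ⟨_, .cons (x := (shear c m, 1)) (shear_mem_elementary c m) affine.one_mem hl,
          by rw [wordProd_cons, hlv, huv]; group⟩
      · have hs1 : (swap * v).val.fst = v.val.snd := pcomp_X_one _ _
        have hs2 : (swap * v).val.snd = v.val.fst := pcomp_X_zero _ _
        obtain ⟨l, hl, hlv⟩ := ih _ (by rw [hs1, hs2, hv1, hv2, ← hn]; lia) (swap * v) rfl
          (by rw [hs1, hs2]; lia)
        exact ⟨_, .cons (x := (shear c m, swap⁻¹)) (shear_mem_elementary c m)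
          (affine.inv_mem swap_mem_affine) hl, by rw [wordProd_cons, hlv, huv]; group⟩
  by_cases hle : u.val.snd.totalDegree ≤ u.val.fst.totalDegree
  · exact main _ u rfl hle
  · have hs1 : (swap * u).val.fst = u.val.snd := pcomp_X_one _ _
    have hs2 : (swap * u).val.snd = u.val.fst := pcomp_X_zero _ _
    obtain ⟨l, hl, hlu⟩ := main _ (swap * u) rfl (by rw [hs1, hs2]; lia)
    exact ⟨_, .cons (x := (1, swap⁻¹)) elementary.one_mem (affine.inv_mem swap_mem_affine) hl,
      by rw [wordProd_cons, hlu]; group⟩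

end PolyAut

end PolynomialMaps

section NormalForms

lemma homogeneousComponent_X_one (i : Fin 2) :
    homogeneousComponent 1 (X i : Poly2) = X i := by
  rw [homogeneousComponent_of_mem (isHomogeneous_X ℂ i), if_pos rfl]

lemma homogeneousComponent_C_eq_zero {n : ℕ} (hn : 1 ≤ n) (c : ℂ) :
    homogeneousComponent n (C c : Poly2) = 0 :=
  homogeneousComponent_eq_zero _ _ (by rw [totalDegree_C]; exact hn)

lemma linear_form_ne_zero {a : ℂ} (ha : a ≠ 0) (b : ℂ) : (C a * X 0 + C b * X 1 : Poly2) ≠ 0 :=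
  fun h => ha (by simpa using congrArg (eval ![1, 0]) h)

namespace PolyMap

/-- The map `f` has degree at most `n`, its first component has degree-`n` part `H`, and its second
component has smaller degree. -/
def FstLeads (n : ℕ) (H : Poly2) (f : PolyMap) : Prop :=
  f.fst.totalDegree ≤ n ∧ homogeneousComponent n f.fst = H ∧ f.snd.totalDegree < n

/-- The map `f` has degree at most `n`, and its second component has degree-`n` part `H`. -/
def SndLeads (n : ℕ) (H : Poly2) (f : PolyMap) : Prop :=
  f.fst.totalDegree ≤ n ∧ f.snd.totalDegree ≤ n ∧ homogeneousComponent n f.snd = H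

lemma sndLeads_one : SndLeads 1 (X 1) 1 := by
  simp [SndLeads, one_fst, one_snd, homogeneousComponent_X_one]

lemma FstLeads.deg_eq {n : ℕ} {H : Poly2} {f : PolyMap} (hf : FstLeads n H f) (hH : H ≠ 0) :
    f.deg = n := by
  obtain ⟨h1, rfl, h3⟩ := hf
  have := le_totalDegree_of_homogeneousComponent_ne_zero hH
  exact le_antisymm (max_le h1 h3.le) (this.trans (le_max_left _ _))

lemma SndLeads.deg_eq {n : ℕ} {H : Poly2} {f : PolyMap} (hf : SndLeads n H f) (hH : H ≠ 0) :
    f.deg = n := by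
  obtain ⟨h1, h2, rfl⟩ := hf
  have := le_totalDegree_of_homogeneousComponent_ne_zero hH
  exact le_antisymm (max_le h1 h2) (this.trans (le_max_right _ _))

lemma isRegularQuad_of_leads {f g : PolyMap} {n m : ℕ} {c γ δ c' : ℂ} (hn : 2 ≤ n) (hm : 2 ≤ m)
    (hc : c ≠ 0) (hγ : γ ≠ 0) (hc' : c' ≠ 0)
    (hf : f.FstLeads n (C c * (C γ * X 0 + C δ * X 1) ^ n))
    (hg : g.SndLeads m (C c' * X 1 ^ m)) : IsRegularQuad f.fst f.snd g.fst g.snd := by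
  have hdf : degPair f.fst f.snd = n := hf.deg_eq
    (mul_ne_zero (C_ne_zero.2 hc) (pow_ne_zero _ (linear_form_ne_zero hγ δ)))
  have hdg : degPair g.fst g.snd = m := hg.deg_eq
    (mul_ne_zero (C_ne_zero.2 hc') (pow_ne_zero _ (X_ne_zero _)))
  refine ⟨hdf ▸ hn, hdg ▸ hm, ?_⟩
  rintro x y hxy ⟨h1, -, -, h4⟩
  rw [hdf, evalHom, hf.2.1] at h1
  rw [hdg, evalHom, hg.2.2] at h4
  have hy : y = 0 := by
    have : c' = 0 ∨ y = 0 ∧ m ≠ 0 := by simpa using h4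
    exact (this.resolve_left hc').1
  subst hy
  have hx : x = 0 := by
    have : c = 0 ∨ (γ = 0 ∨ x = 0) ∧ n ≠ 0 := by simpa using h1
    exact (this.resolve_left hc).1.resolve_left hγ
  exact hxy (by rw [hx])

end PolyMap

namespace PolyAut

open PolyMap

lemma leads_of_affine {a : PolyAut} (ha : a ∈ affine) (ha' : a ∉ elementary) :
    ∃ γ δ : ℂ, γ ≠ 0 ∧ SndLeads 1 (C γ * X 0 + C δ * X 1) a.val ∧
      ∀ (f : PolyMap) (n : ℕ) (H : Poly2), 1 ≤ n → FstLeads n H f →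
        SndLeads n (C γ * H) (a.val * f) := by
  have h1 : a.val.fst.totalDegree ≤ 1 := (le_max_left _ _).trans ha
  have h2 : a.val.snd.totalDegree ≤ 1 := (le_max_right _ _).trans ha
  obtain ⟨α, β, ε, e1⟩ := exists_eq_linear h1
  obtain ⟨γ, δ, ζ, e2⟩ := exists_eq_linear h2
  refine ⟨γ, δ, ?_, ⟨h1, h2, ?_⟩, ?_⟩
  · rintro rfl
    refine ha' ⟨1, α, δ, ζ, Polynomial.C β * Polynomial.X + Polynomial.C ε,
      Polynomial.natDegree_linear_le, ?_, ?_⟩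
    · rw [e1]
      simp [algebraMap_eq, add_assoc]
    · rw [e2]
      simp
  · rw [e2]
    simp only [map_add, homogeneousComponent_C_mul, homogeneousComponent_X_one,
      homogeneousComponent_C_eq_zero le_rfl, add_zero]
  · rintro f n H hn ⟨hf1, rfl, hf3⟩
    have bound : ∀ F : Poly2, F.totalDegree ≤ 1 → (pcomp F f.fst f.snd).totalDegree ≤ n :=
      fun F hF => (totalDegree_pcomp_le _ _ _).trans
        ((Nat.mul_le_mul hF (max_le hf1 hf3.le)).trans (one_mul n).le)
    refine ⟨bound _ h1, bound _ h2, ?_⟩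
    have : (a.val * f).snd = C γ * f.fst + C δ * f.snd + C ζ := by
      rw [mul_snd, e2]
      simp [pcomp]
    rw [this]
    simp only [map_add, homogeneousComponent_C_mul, homogeneousComponent_C_eq_zero hn,
      homogeneousComponent_eq_zero _ _ hf3, add_zero, mul_zero]

lemma leads_of_elementary {e : PolyAut} (he : e ∈ elementary) (he' : e ∉ affine) :
    ∃ (d : ℕ) (c : ℂ), 2 ≤ d ∧ c ≠ 0 ∧
      ∀ (f : PolyMap) (n : ℕ) (H : Poly2), 1 ≤ n → SndLeads n H f →
        FstLeads (d * n) (C c * H ^ d) (e.val * f) := by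
  obtain ⟨D, a, b, c, p, -, h1, h2⟩ := he
  have hd : 2 ≤ p.natDegree := by
    by_contra! hlt
    exact he' ((IsElementary.deg_le ⟨a, b, c, p, le_rfl, h1, h2⟩).trans (by lia))
  refine ⟨p.natDegree, p.leadingCoeff, hd, ?_, ?_⟩
  · rw [Ne, Polynomial.leadingCoeff_eq_zero]
    rintro rfl
    simp at hd
  · rintro f n H hn ⟨hf1, hf2, rfl⟩
    have hlt : n < p.natDegree * n := by nlinarith
    have g1 : (e.val * f).fst = C a * f.fst + Polynomial.aeval f.snd p := by
      rw [mul_fst, h1, ← pcomp_X_one f.fst f.snd, ← pcomp_aeval]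
      simp [pcomp]
    have g2 : (e.val * f).snd = C b * f.snd + C c := by
      rw [mul_snd, h2]
      simp [pcomp]
    have hC : ∀ (a : ℂ) {F : Poly2}, F.totalDegree ≤ n → (C a * F).totalDegree ≤ n :=
      fun a F hF => (totalDegree_mul _ _).trans (by simpa using hF)
    refine ⟨?_, ?_, ?_⟩
    · rw [g1]
      exact (totalDegree_add _ _).trans
        (max_le ((hC a hf1).trans hlt.le) (totalDegree_aeval_le le_rfl hf2))
    · rw [g1, map_add, homogeneousComponent_eq_zero _ _ ((hC a hf1).trans_lt hlt), zero_add,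
        homogeneousComponent_aeval hn le_rfl hf2]
      rfl
    · rw [g2]
      exact ((totalDegree_add _ _).trans (max_le (hC b hf2) (by simp))).trans_lt hlt

/-- A word is reduced if none of its letters is both elementary and affine. -/
def IsReduced (l : List (PolyAut × PolyAut)) : Prop :=
  ∀ x ∈ l, x.1 ∉ affine ∧ x.2 ∉ elementary

lemma fstLeads_wordProd {l : List (PolyAut × PolyAut)} (hl : IsWord l) (hr : IsReduced l)
    (hne : l ≠ []) : ∃ (n : ℕ) (c γ δ : ℂ), 2 ≤ n ∧ c ≠ 0 ∧ γ ≠ 0 ∧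
      FstLeads n (C c * (C γ * X 0 + C δ * X 1) ^ n) (wordProd l).val := by
  induction l with
  | nil => exact absurd rfl hne
  | cons x l ih =>
    obtain ⟨hx, hl⟩ := List.forall_mem_cons.1 hl
    obtain ⟨hx', hr⟩ := List.forall_mem_cons.1 hr
    obtain ⟨γ, δ, hγ, h1, hstep⟩ := leads_of_affine hx.2 hx'.2
    obtain ⟨d, c, hd, hc, hlead⟩ := leads_of_elementary hx.1 hx'.1
    rcases eq_or_ne l [] with rfl | hne
    · refine ⟨d, c, γ, δ, hd, hc, hγ, ?_⟩
      simpa [wordProd] using hlead _ _ _ le_rfl h1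
    · obtain ⟨n, c', γ', δ', hn, hc', hγ', hf⟩ := ih hl hr hne
      refine ⟨d * n, c * (γ * c') ^ d, γ', δ', by nlinarith,
        mul_ne_zero hc (pow_ne_zero _ (mul_ne_zero hγ hc')), hγ', ?_⟩
      have := hlead _ _ _ (by lia) (hstep _ _ _ (by lia) hf)
      rw [wordProd_cons, mul_assoc, Units.val_mul, Units.val_mul]
      convert this using 1
      simp only [C_mul, C_pow]
      ring

lemma sndLeads_wordProd_inv {l : List (PolyAut × PolyAut)} (hl : IsWord l) (hr : IsReduced l) :
    ∃ (n : ℕ) (c : ℂ), 1 ≤ n ∧ (l ≠ [] → 2 ≤ n) ∧ c ≠ 0 ∧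
      SndLeads n (C c * X 1 ^ n) (wordProd l)⁻¹.val := by
  induction l using List.reverseRecOn with
  | nil => exact ⟨1, 1, le_rfl, fun h => absurd rfl h, one_ne_zero,
      by simpa [wordProd] using sndLeads_one⟩
  | append_singleton l x ih =>
    obtain ⟨n, c, hn, -, hc, hf⟩ := ih (fun y hy => hl y (List.mem_append_left _ hy))
      (fun y hy => hr y (List.mem_append_left _ hy))
    have hx := hl x (by simp)
    have hx' := hr x (by simp)
    obtain ⟨γ, δ, hγ, -, hstep⟩ := leads_of_affine (affine.inv_mem hx.2)
      fun h => hx'.2 (elementary.inv_mem_iff.1 h)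
    obtain ⟨d, c', hd, hc', hlead⟩ := leads_of_elementary (elementary.inv_mem hx.1)
      fun h => hx'.1 (affine.inv_mem_iff.1 h)
    refine ⟨d * n, γ * (c' * c ^ d), by nlinarith, fun _ => by nlinarith,
      mul_ne_zero hγ (mul_ne_zero hc' (pow_ne_zero _ hc)), ?_⟩
    have := hstep _ _ _ (by nlinarith) (hlead _ _ _ hn hf)
    have hw : (wordProd (l ++ [x]))⁻¹ = x.2⁻¹ * (x.1⁻¹ * (wordProd l)⁻¹) := by
      simp [wordProd, mul_assoc]
    rw [hw, Units.val_mul, Units.val_mul]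
    convert this using 1
    simp only [C_mul, C_pow]
    ring

/-- Nonempty reduced words are regular. -/
lemma isRegularQuad_wordProd {l : List (PolyAut × PolyAut)} (hl : IsWord l) (hr : IsReduced l)
    (hne : l ≠ []) : IsRegularQuad (wordProd l).val.fst (wordProd l).val.snd
      (wordProd l)⁻¹.val.fst (wordProd l)⁻¹.val.snd := by
  obtain ⟨n, c, γ, δ, hn, hc, hγ, hf⟩ := fstLeads_wordProd hl hr hne
  obtain ⟨m, c', -, hm, hc', hg⟩ := sndLeads_wordProd_inv hl hr
  exact isRegularQuad_of_leads hn (hm hne) hc hγ hc' hf hg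

lemma isConj_mul_comm (u v : PolyAut) : IsConj (u * v) (v * u) :=
  isConj_iff.2 ⟨u⁻¹, by group⟩

/-- Every plane automorphism is conjugate to an affine or elementary one, or to a nonempty reduced
word. -/
theorem isConj_normal_form (u : PolyAut) :
    (∃ v, IsConj u v ∧ (v ∈ affine ∨ v ∈ elementary)) ∨
      ∃ l, IsWord l ∧ IsReduced l ∧ l ≠ [] ∧ IsConj u (wordProd l) := by
  by_contra! hcon
  obtain ⟨hcon1, hcon2⟩ := hcon
  have main : ∀ (n : ℕ) (l : List (PolyAut × PolyAut)), l.length = n → IsWord l →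
      ¬ IsConj u (wordProd l) := by
    intro n
    induction n using Nat.strong_induction_on with
    | _ n ih =>
    intro l hn hl hu
    have hne : l ≠ [] := by
      rintro rfl
      exact (hcon1 _ hu).1 affine.one_mem
    have hnr : ¬ IsReduced l := fun hr => hcon2 l hl hr hne hu
    simp only [IsReduced, not_forall] at hnr
    obtain ⟨⟨e, a⟩, hx, hxr⟩ := hnr
    obtain ⟨s, t, rfl⟩ := List.append_of_mem hx
    obtain ⟨he, ha⟩ := hl _ hx
    have hu' : IsConj u (e * a * wordProd (t ++ s)) := by
      refine hu.trans ?_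
      rw [wordProd_append]
      refine (isConj_mul_comm _ _).trans ?_
      rw [wordProd_cons, mul_assoc, ← wordProd_append]
    have hts : IsWord (t ++ s) := fun y hy => hl y (by
      rcases List.mem_append.1 hy with h | h <;> simp [h])
    have hlen : (t ++ s).length + 1 = n := by
      rw [← hn]
      simp only [List.length_append, List.length_cons]
      lia
    clear hu hl hn hx hne
    generalize t ++ s = r at hu' hts hlen
    simp only [not_and_or, not_not] at hxr
    rcases hxr with he' | ha'
    · rcases List.eq_nil_or_concat r with rfl | ⟨r, ⟨e', a'⟩, rfl⟩
      · refine (hcon1 _ hu').1 ?_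
        simpa [wordProd] using affine.mul_mem he' ha
      · rw [List.concat_eq_append] at hu' hts hlen
        obtain ⟨hy1, hy2⟩ := hts (e', a') (by simp)
        refine ih _ ?_ ((e', a' * e * a) :: r) rfl (IsWord.cons hy1 ?_ ?_) (hu'.trans ?_)
        · simp at hlen ⊢
          lia
        · exact affine.mul_mem (affine.mul_mem hy2 he') ha
        · exact fun y hy => hts y (List.mem_append_left _ hy)
        · rw [wordProd_append, ← mul_assoc]
          refine (isConj_mul_comm _ _).trans ?_
          convert IsConj.refl _ using 1
          simp [wordProd, mul_assoc]
    · rcases r with _ | ⟨⟨e', a'⟩, r⟩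
      · refine (hcon1 _ hu').2 ?_
        simpa [wordProd] using elementary.mul_mem he ha'
      · obtain ⟨⟨hy1, hy2⟩, hr⟩ := List.forall_mem_cons.1 hts
        refine ih _ ?_ ((e * a * e', a') :: r) rfl
          (IsWord.cons (elementary.mul_mem (elementary.mul_mem he ha') hy1) hy2 hr)
          (hu'.trans ?_)
        · simp at hlen ⊢
          lia
        · convert IsConj.refl _ using 1
          simp [wordProd, mul_assoc]
  obtain ⟨l, hl, rfl⟩ := exists_wordProd_eq u
  exact main _ l rfl hl (IsConj.refl _)

lemma _root_.pcomp_eq_X {P Q P' Q' : Poly2}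
    (h : ∀ z, evalPair P Q (evalPair P' Q' z) = z) :
    pcomp P P' Q' = X 0 ∧ pcomp Q P' Q' = X 1 := by
  have key : ∀ z : Fin 2 → ℂ, z = ![z 0, z 1] := fun z => by
    ext i
    fin_cases i <;> rfl
  constructor <;> refine MvPolynomial.funext fun z => ?_ <;> rw [eval_pcomp, eval_X, key z]
  · exact congrArg Prod.fst (h (z 0, z 1))
  · exact congrArg Prod.snd (h (z 0, z 1))

/-- The automorphism given by a pair of mutually inverse polynomial maps. -/
def ofIsInverseQuad {P Q P' Q' : Poly2} (h : IsInverseQuad P Q P' Q') : PolyAut where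
  val := ⟨P, Q⟩
  inv := ⟨P', Q'⟩
  val_inv := PolyMap.ext (pcomp_eq_X h.2).1 (pcomp_eq_X h.2).2
  inv_val := PolyMap.ext (pcomp_eq_X h.1).1 (pcomp_eq_X h.1).2

lemma isInverseQuad (u : PolyAut) :
    IsInverseQuad u.val.fst u.val.snd u⁻¹.val.fst u⁻¹.val.snd := by
  have main : ∀ u : PolyAut, ∀ z, evalPair u.val.fst u.val.snd
      (evalPair u⁻¹.val.fst u⁻¹.val.snd z) = z := fun u z => by
    obtain ⟨h1, h2⟩ := pcomp_inv u
    refine Prod.ext ?_ ?_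
    · simpa [eval_pcomp, evalPair] using congrArg (eval ![z.1, z.2]) h1
    · simpa [eval_pcomp, evalPair] using congrArg (eval ![z.1, z.2]) h2
  exact ⟨by simpa using main u⁻¹, main u⟩

lemma iterPair_eq (u : PolyAut) (n : ℕ) :
    iterPair u.val.fst u.val.snd n = ((u ^ n).val.fst, (u ^ n).val.snd) := by
  induction n with
  | zero => rfl
  | succ n ih =>
    rw [iterPair, ih, pow_succ']
    rfl

lemma degIter_eq (u : PolyAut) (n : ℕ) : degIter u.val.fst u.val.snd n = (u ^ n).val.deg := by
  rw [degIter, iterPair_eq]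
  rfl

lemma subadditive_log_deg (u : PolyAut) :
    Subadditive fun n : ℕ => Real.log ((u ^ n).val.deg : ℝ) := by
  intro m n
  have pos : ∀ k : ℕ, (0 : ℝ) < (u ^ k).val.deg := fun k => by exact_mod_cast one_le_deg (u ^ k)
  dsimp only
  rw [← Real.log_mul (pos m).ne' (pos n).ne', pow_add]
  refine Real.log_le_log ?_ ?_
  · exact_mod_cast one_le_deg (u ^ m * u ^ n)
  · exact_mod_cast PolyMap.deg_mul_le (u ^ m).val (u ^ n).val

lemma tendsto_log_deg (u : PolyAut) :
    Tendsto (fun n : ℕ => Real.log ((u ^ n).val.deg : ℝ) / n) atTop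
      (nhds (subadditive_log_deg u).lim) := by
  refine (subadditive_log_deg u).tendsto_lim ⟨0, ?_⟩
  rintro _ ⟨n, rfl⟩
  exact div_nonneg (Real.log_natCast_nonneg _) n.cast_nonneg

lemma tendsto_degIter (u : PolyAut) :
    Tendsto (fun n : ℕ => (degIter u.val.fst u.val.snd n : ℝ) ^ ((n : ℝ)⁻¹)) atTop
      (nhds (Real.exp (subadditive_log_deg u).lim)) := by
  refine ((Real.continuous_exp.tendsto _).comp (tendsto_log_deg u)).congr fun n => ?_
  rw [degIter_eq, Real.rpow_def_of_pos (by exact_mod_cast one_le_deg (u ^ n)), ← div_eq_mul_inv]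
  rfl

lemma lim_eq_zero_of_deg_pow_le {u : PolyAut} {D : ℕ} (hD : ∀ n : ℕ, (u ^ n).val.deg ≤ D) :
    (subadditive_log_deg u).lim = 0 := by
  refine tendsto_nhds_unique (tendsto_log_deg u) ?_
  refine squeeze_zero (fun n => div_nonneg (Real.log_natCast_nonneg _) n.cast_nonneg)
    (fun n => ?_) (tendsto_const_div_atTop_nhds_zero_nat (Real.log D))
  refine div_le_div_of_nonneg_right (Real.log_le_log ?_ ?_) n.cast_nonneg
  · exact_mod_cast one_le_deg (u ^ n)
  · exact_mod_cast hD n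

end PolyAut

end NormalForms
/-- The first dynamical degree `λ(f) = lim (deg fⁿ)^{1/n}` of a plane polynomial automorphism
exists, and if `λ(f) > 1` then `f` is conjugate in `Aut(ℂ²)` to a regular automorphism. -/
theorem dynamical_degree_exists_and_conjugate_regular (P Q P' Q' : Poly2)
    (hinv : IsInverseQuad P Q P' Q') :
    ∃ lam : ℝ, Tendsto (fun n : ℕ => (degIter P Q n : ℝ) ^ ((n : ℝ)⁻¹))
        atTop (nhds lam) ∧
      (1 < lam → ∃ A B A' B' : Poly2, IsInverseQuad A B A' B' ∧
        IsRegularQuad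
          (pcomp A' (pcomp P A B) (pcomp Q A B)) (pcomp B' (pcomp P A B) (pcomp Q A B))
          (pcomp A' (pcomp P' A B) (pcomp Q' A B)) (pcomp B' (pcomp P' A B) (pcomp Q' A B))) := by
  set u : PolyAut := PolyAut.ofIsInverseQuad hinv
  refine ⟨_, u.tendsto_degIter, fun hlam => ?_⟩
  rcases u.isConj_normal_form with ⟨v, huv, hv⟩ | ⟨l, hl, hr, hne, hul⟩
  · obtain ⟨D, hD⟩ := PolyAut.exists_deg_pow_le_of_isConj huv hv
    rw [PolyAut.lim_eq_zero_of_deg_pow_le hD, Real.exp_zero] at hlam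
    exact absurd hlam (lt_irrefl _)
  · obtain ⟨c, hc⟩ := isConj_iff.1 hul
    refine ⟨c⁻¹.val.fst, c⁻¹.val.snd, c.val.fst, c.val.snd,
      by simpa using PolyAut.isInverseQuad c⁻¹, ?_⟩
    have h1 : c * (u * c⁻¹) = PolyAut.wordProd l := by rw [← hc, mul_assoc]
    have h2 : c * (u⁻¹ * c⁻¹) = (PolyAut.wordProd l)⁻¹ := by rw [← h1]; group
    have := PolyAut.isRegularQuad_wordProd hl hr hne
    rw [← h2, ← h1] at this
    exact this
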